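/- arXiv:1711.07332 — 9 statements merged into one kernel-verified Lean document; each statement's English description precedes it below -/
import Mathlib

section
/- Lyapunov derivative under decentralized pure integral control (key step in Theorem 2): Let n ≥ 1, let B : Fin n → Fin n → ℝ be symmetric, V : Fin n → ℝ, and let M_i, D_i, T_i > 0, P* ∈ ℝⁿ, θ₀' ∈ ℝⁿ. Let θ, ω : ℝ → ℝⁿ be differentiable and satisfy, for all t and all i, θ_i'(t) = ω_i(t) and M_i ω_i'(t) = −D_i ω_i(t) + P*_i − Σ_j B_ij V_i V_j sin(θ_i(t) − θ_j(t)) − T_i^{-1}(θ_i(t) − θ₀'_i). Define V(θ, ω) = (1/2) Σ_i M_i ω_i² − (1/2) Σ_{i,j} B_ij V_i V_j cos(θ_i − θ_j) − Σ_i θ_i P*_i + (1/2) Σ_i T_i^{-1} (θ_i − θ₀'_i)². Then for every t, the function t ↦ V(θ(t), ω(t)) is differentiable with derivative equal to −Σ_i D_i ω_i(t)². -/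
/-- Pairing an antisymmetric array with differences of a vector counts each row twice. -/
theorem sum_sum_antisymm_mul_sub {ι R : Type*} [Fintype ι] [CommRing R] (S : ι → ι → R)
    (hS : ∀ i j, S j i = -S i j) (w : ι → R) :
    ∑ i, ∑ j, S i j * (w i - w j) = 2 * ∑ i, w i * ∑ j, S i j := by
  have hswap : ∑ i, ∑ j, S i j * w j = -∑ i, ∑ j, S i j * w i := by
    rw [Finset.sum_comm]
    simp only [← Finset.sum_neg_distrib]
    refine Finset.sum_congr rfl fun i _ => Finset.sum_congr rfl fun j _ => ?_
    rw [hS, neg_mul]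
  have hrow : ∑ i, w i * ∑ j, S i j = ∑ i, ∑ j, S i j * w i := by
    simp only [Finset.mul_sum, mul_comm]
  simp only [mul_sub, Finset.sum_sub_distrib]
  rw [hswap, hrow]
  ring

/-- Lyapunov derivative under decentralized pure integral control (key step in
Theorem 2): along solutions of the closed loop
`θ̇ = ω`, `M ω̇ = −D ω + P* − ∇U(θ) − T⁻¹(θ − θ₀')`,
the LaSalle function
`V(θ,ω) = ½ Σ M_i ω_i² − ½ Σ_{i,j} B_ij V_i V_j cos(θ_i − θ_j) − Σ θ_i P*_i
          + ½ Σ T_i⁻¹ (θ_i − θ₀'_i)²`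
is differentiable in time with derivative `−Σ_i D_i ω_i(t)²`. -/
theorem lyapunov_derivative_pure_integral
    (n : ℕ) (hn : 1 ≤ n)
    (B : Fin n → Fin n → ℝ) (hB : ∀ i j, B i j = B j i)
    (V M D T Pstar θ0' : Fin n → ℝ)
    (hM : ∀ i, 0 < M i) (hD : ∀ i, 0 < D i) (hT : ∀ i, 0 < T i)
    (θ ω ω' : ℝ → Fin n → ℝ)
    (hθ : ∀ t i, HasDerivAt (fun s => θ s i) (ω t i) t)
    (hω : ∀ t i, HasDerivAt (fun s => ω s i) (ω' t i) t)
    (hswing : ∀ t i, M i * ω' t i =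
      - D i * ω t i + Pstar i
        - (∑ j, B i j * V i * V j * Real.sin (θ t i - θ t j))
        - (T i)⁻¹ * (θ t i - θ0' i)) :
    ∀ t, HasDerivAt (fun s =>
        (1/2) * ∑ i, M i * (ω s i)^2
        - (1/2) * ∑ i, ∑ j, B i j * V i * V j * Real.cos (θ s i - θ s j)
        - ∑ i, θ s i * Pstar i
        + (1/2) * ∑ i, (T i)⁻¹ * (θ s i - θ0' i)^2)
      (- ∑ i, D i * (ω t i)^2) t := by
  intro t
  have hkin : HasDerivAt (fun s => ∑ i, M i * (ω s i)^2)
      (∑ i, 2 * (ω t i * (M i * ω' t i))) t := by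
    refine HasDerivAt.fun_sum fun i _ => ?_
    refine (((hω t i).fun_pow 2).const_mul (M i)).congr_deriv ?_
    push_cast
    ring
  have hcos : HasDerivAt
      (fun s => ∑ i, ∑ j, B i j * V i * V j * Real.cos (θ s i - θ s j))
      (∑ i, ∑ j, -(B i j * V i * V j * Real.sin (θ t i - θ t j) * (ω t i - ω t j))) t := by
    refine HasDerivAt.fun_sum fun i _ => HasDerivAt.fun_sum fun j _ => ?_
    refine ((((hθ t i).fun_sub (hθ t j)).cos).const_mul (B i j * V i * V j)).congr_deriv ?_
    ring
  have hlin : HasDerivAt (fun s => ∑ i, θ s i * Pstar i) (∑ i, ω t i * Pstar i) t :=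
    HasDerivAt.fun_sum fun i _ => (hθ t i).mul_const (Pstar i)
  have hint : HasDerivAt (fun s => ∑ i, (T i)⁻¹ * (θ s i - θ0' i)^2)
      (∑ i, 2 * (ω t i * ((T i)⁻¹ * (θ t i - θ0' i)))) t := by
    refine HasDerivAt.fun_sum fun i _ => ?_
    refine ((((hθ t i).sub_const (θ0' i)).fun_pow 2).const_mul (T i)⁻¹).congr_deriv ?_
    push_cast
    ring
  have hsym := sum_sum_antisymm_mul_sub
    (fun i j => B i j * V i * V j * Real.sin (θ t i - θ t j))
    (fun i j => by
      rw [hB j i, ← neg_sub (θ t i) (θ t j), Real.sin_neg]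
      ring) (ω t)
  refine ((((hkin.const_mul (1/2)).fun_sub (hcos.const_mul (1/2))).fun_sub hlin).fun_add
    (hint.const_mul (1/2))).congr_deriv ?_
  simp only [Finset.sum_neg_distrib]
  rw [hsym, ← Finset.mul_sum, ← Finset.mul_sum]
  have hbalance : ∑ i, ω t i * (M i * ω' t i) =
      -∑ i, D i * (ω t i)^2 + ∑ i, ω t i * Pstar i
        - ∑ i, ω t i * ∑ j, B i j * V i * V j * Real.sin (θ t i - θ t j)
        - ∑ i, ω t i * ((T i)⁻¹ * (θ t i - θ0' i)) := by
    rw [← Finset.sum_neg_distrib, ← Finset.sum_add_distrib, ← Finset.sum_sub_distrib,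
      ← Finset.sum_sub_distrib]
    refine Finset.sum_congr rfl fun i _ => ?_
    rw [hswing]
    ring
  rw [hbalance]
  ring
end

section
/- Non-robustness of biased decentralized integral control: Let n ≥ 1, let B : Fin n → Fin n → ℝ be symmetric, V : Fin n → ℝ, D_i, T_i > 0, P*, η ∈ ℝⁿ, θ₀ ∈ ℝⁿ and ω_sync ∈ ℝ. Suppose θ(t) = θ₀ + t ω_sync 𝟙, ω(t) = ω_sync 𝟙, and a differentiable p : ℝ → ℝⁿ form a synchronous solution of the swing equations under biased integral control, i.e., for all t and all i: 0 = −D_i ω_sync + P*_i − Σ_j B_ij V_i V_j sin(θ_i(t) − θ_j(t)) − p_i(t) and T_i p_i'(t) = ω_sync + η_i. Then η = −ω_sync 𝟙; in particular the measurement bias η lies in the span of the all-ones vector 𝟙. -/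
/-- Non-robustness of biased decentralized integral control: a synchronous
solution of the swing equations under biased integral control
(`0 = −D_i ω_sync + P*_i − (∇U(θ(t)))_i − p_i(t)`, `T_i ṗ_i = ω_sync + η_i`,
with `θ(t) = θ₀ + t ω_sync 𝟙`) forces the bias `η` to equal `−ω_sync 𝟙`;
in particular `η` lies in the span of the all-ones vector. -/
theorem biased_integral_control_requires_uniform_bias
    (n : ℕ) (hn : 1 ≤ n)
    (B : Fin n → Fin n → ℝ) (hB : ∀ i j, B i j = B j i)
    (V D T Pstar η θ0 : Fin n → ℝ)
    (hD : ∀ i, 0 < D i) (hT : ∀ i, 0 < T i)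
    (ωsync : ℝ) (p p' : ℝ → Fin n → ℝ)
    (hp : ∀ t i, HasDerivAt (fun s => p s i) (p' t i) t)
    (hswing : ∀ t i, (0 : ℝ) =
      - D i * ωsync + Pstar i
        - (∑ j, B i j * V i * V j *
            Real.sin ((θ0 i + t * ωsync) - (θ0 j + t * ωsync)))
        - p t i)
    (hctrl : ∀ t i, T i * p' t i = ωsync + η i) :
    (η = fun _ => -ωsync) ∧
      η ∈ Submodule.span ℝ ({fun _ => (1 : ℝ)} : Set (Fin n → ℝ)) := by
  have hconst : ∀ t i, p t i = p 0 i := fun t i => by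
    have h := hswing t i
    have h0 := hswing 0 i
    simp only [add_sub_add_right_eq_sub] at h h0
    linarith
  have hη : η = fun _ => -ωsync := by
    funext i
    have hderiv : HasDerivAt (fun s => p s i) 0 0 := by
      simpa only [hconst _ i] using hasDerivAt_const (0 : ℝ) (p 0 i)
    have hctrl0 := hctrl 0 i
    rw [(hp 0 i).unique hderiv, mul_zero] at hctrl0
    linarith
  refine ⟨hη, Submodule.mem_span_singleton.2 ⟨-ωsync, ?_⟩⟩
  rw [hη]
  funext i
  simp
end

section
/- Steady-state frequency under leaky integral control (Lemma 5): Let n ≥ 1, let B : Fin n → Fin n → ℝ be symmetric, V : Fin n → ℝ, D_i > 0, K_i > 0, and P* ∈ ℝⁿ. Suppose θ* ∈ ℝⁿ, p* ∈ ℝⁿ and ω_sync ∈ ℝ form a leaky-integral equilibrium, i.e., for every i: 0 = −D_i ω_sync + P*_i − Σ_j B_ij V_i V_j sin(θ*_i − θ*_j) − p*_i and 0 = ω_sync − K_i p*_i. Then ω_sync = (Σ_{i=1}^n P*_i) / (Σ_{i=1}^n (D_i + K_i^{-1})). -/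
/-- The power-flow terms of a symmetric network cancel in total. -/
theorem sum_powerFlow_eq_zero {ι : Type*} [Fintype ι] {B : ι → ι → ℝ}
    (hB : ∀ i j, B i j = B j i) (V θ : ι → ℝ) :
    ∑ i, ∑ j, B i j * V i * V j * Real.sin (θ i - θ j) = 0 := by
  have hneg : ∑ i, ∑ j, B i j * V i * V j * Real.sin (θ i - θ j)
      = -∑ i, ∑ j, B i j * V i * V j * Real.sin (θ i - θ j) := by
    conv_lhs => rw [Finset.sum_comm]
    simp only [← Finset.sum_neg_distrib]
    refine Finset.sum_congr rfl fun i _ => Finset.sum_congr rfl fun j _ => ?_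
    rw [hB j i, ← neg_sub (θ i) (θ j), Real.sin_neg]
    ring
  linarith

/-- Steady-state frequency under leaky integral control (Lemma 5):
at a leaky-integral equilibrium,
`ω_sync = (Σ_i P*_i) / (Σ_i (D_i + K_i⁻¹))`. -/
theorem leaky_integral_steady_state_frequency
    (n : ℕ) (hn : 1 ≤ n)
    (B : Fin n → Fin n → ℝ) (hB : ∀ i j, B i j = B j i)
    (V D K Pstar θstar pstar : Fin n → ℝ)
    (hD : ∀ i, 0 < D i) (hK : ∀ i, 0 < K i)
    (ωsync : ℝ)
    (heq1 : ∀ i, (0 : ℝ) = - D i * ωsync + Pstar i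
      - (∑ j, B i j * V i * V j * Real.sin (θstar i - θstar j)) - pstar i)
    (heq2 : ∀ i, (0 : ℝ) = ωsync - K i * pstar i) :
    ωsync = (∑ i, Pstar i) / (∑ i, (D i + (K i)⁻¹)) := by
  have : Nonempty (Fin n) := ⟨⟨0, hn⟩⟩
  have hpos : 0 < ∑ i, (D i + (K i)⁻¹) :=
    Finset.sum_pos (fun i _ => add_pos (hD i) (inv_pos.mpr (hK i))) Finset.univ_nonempty
  have hbus : ∀ i, ωsync * (D i + (K i)⁻¹) = Pstar i
      - ∑ j, B i j * V i * V j * Real.sin (θstar i - θstar j) := by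
    intro i
    have hp : pstar i = ωsync * (K i)⁻¹ := by
      rw [eq_mul_inv_iff_mul_eq₀ (hK i).ne']
      linarith [heq2 i]
    linarith [heq1 i]
  rw [eq_div_iff hpos.ne', Finset.mul_sum, Finset.sum_congr rfl fun i _ => hbus i,
    Finset.sum_sub_distrib, sum_powerFlow_eq_zero hB, sub_zero]
end

section
/- Banded frequency restoration (Corollary 6): Let n ≥ 1, let B : Fin n → Fin n → ℝ be symmetric, V : Fin n → ℝ, D_i > 0, K_i > 0, P* ∈ ℝⁿ, and let (θ*, p*, ω_sync) be a leaky-integral equilibrium. Given ε > 0, if Σ_{i=1}^n K_i^{-1} ≥ |Σ_{i=1}^n P*_i| / ε − Σ_{i=1}^n D_i, then |ω_sync| ≤ ε. -/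
/-- A double sum of an antisymmetric kernel vanishes. -/
theorem sum_sum_eq_zero_of_antisymm {ι : Type*} [Fintype ι] (f : ι → ι → ℝ)
    (hf : ∀ i j, f i j = - f j i) : ∑ i, ∑ j, f i j = 0 := by
  have h : ∑ i, ∑ j, f i j = - ∑ i, ∑ j, f i j := by
    conv_lhs => rw [Finset.sum_comm]
    simp only [← Finset.sum_neg_distrib]
    exact Finset.sum_congr rfl fun i _ => Finset.sum_congr rfl fun j _ => hf j i
  linarith

/-- Banded frequency restoration (Corollary 6): at a leaky-integral
equilibrium, if `Σ_i K_i⁻¹ ≥ |Σ_i P*_i|/ε − Σ_i D_i` for some `ε > 0`,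
then `|ω_sync| ≤ ε`. -/
theorem banded_frequency_restoration
    (n : ℕ) (hn : 1 ≤ n)
    (B : Fin n → Fin n → ℝ) (hB : ∀ i j, B i j = B j i)
    (V D K Pstar θstar pstar : Fin n → ℝ)
    (hD : ∀ i, 0 < D i) (hK : ∀ i, 0 < K i)
    (ωsync : ℝ)
    (heq1 : ∀ i, (0 : ℝ) = - D i * ωsync + Pstar i
      - (∑ j, B i j * V i * V j * Real.sin (θstar i - θstar j)) - pstar i)
    (heq2 : ∀ i, (0 : ℝ) = ωsync - K i * pstar i)
    (ε : ℝ) (hε : 0 < ε)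
    (hgain : ∑ i, (K i)⁻¹ ≥ |∑ i, Pstar i| / ε - ∑ i, D i) :
    |ωsync| ≤ ε := by
  have hflow : ∑ i, ∑ j, B i j * V i * V j * Real.sin (θstar i - θstar j) = 0 := by
    refine sum_sum_eq_zero_of_antisymm _ fun i j => ?_
    rw [hB i j, ← neg_sub (θstar j) (θstar i), Real.sin_neg]
    ring
  have hp : ∀ i, pstar i = (K i)⁻¹ * ωsync := fun i => by
    rw [eq_inv_mul_iff_mul_eq₀ (hK i).ne']
    linarith [heq2 i]
  have hbalance : ωsync * (∑ i, D i + ∑ i, (K i)⁻¹) = ∑ i, Pstar i := by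
    have hsum := Finset.sum_congr (rfl : (Finset.univ : Finset (Fin n)) = _) fun i _ => heq1 i
    simp only [hp, Finset.sum_sub_distrib, Finset.sum_add_distrib, hflow, neg_mul,
      Finset.sum_neg_distrib, ← Finset.sum_mul, Finset.sum_const_zero] at hsum
    linarith
  have hne : (Finset.univ : Finset (Fin n)).Nonempty := ⟨⟨0, hn⟩, Finset.mem_univ _⟩
  have hpos : 0 < ∑ i, D i + ∑ i, (K i)⁻¹ :=
    add_pos (Finset.sum_pos (fun i _ => hD i) hne)
      (Finset.sum_pos (fun i _ => inv_pos.mpr (hK i)) hne)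
  have hle : |∑ i, Pstar i| ≤ (∑ i, D i + ∑ i, (K i)⁻¹) * ε :=
    (div_le_iff₀ hε).mp (by linarith)
  rw [← hbalance, abs_mul, abs_of_pos hpos, mul_comm] at hle
  exact le_of_mul_le_mul_left hle hpos
end

section
/- Per-mode H2 computation under leaky integral control (Theorem 8, nonzero eigenvalue mode): Let m, d, τ, k, σ_ζ, σ_η > 0 and λ > 0. Define the real 3×3 matrix A = [[0, 1, 0], [−λ/m, −d/m, −1/m], [0, 1/τ, −k/τ]], the 3×2 matrix B = [[0, 0], [σ_ζ/m, 0], [0, σ_η/τ]], and the 1×3 matrix C = [0, 1, 0]. Set q₃₃ = 1 / (2d ((m/τ²) k² + (m/(dτ²) + d/τ) k + 1/τ + λ)), q₁₁ = (λ/d)(−(k m/τ²) q₃₃ + 1/2) − (λ/τ) q₃₃, q₁₂ = 0, q₁₃ = λ q₃₃, q₂₂ = (m/d)(−(k m/τ²) q₃₃ + 1/2), q₂₃ = −(k m/τ) q₃₃, and let Q be the symmetric 3×3 matrix with these entries (Q_ij = q_ij = q_ji). Then Q satisfies the Lyapunov equation Aᵀ Q + Q A = −Cᵀ C, and the trace satisfies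 tr(Bᵀ Q B) = ((k/τ²)(−σ_ζ²/d + σ_η²/k)) / (2d ((m/τ²) k² + (m/(dτ²) + d/τ) k + 1/τ + λ)) + σ_ζ²/(2 m d). -/
open Matrix

/-- Per-mode H2 computation under leaky integral control (Theorem 8, nonzero
eigenvalue mode): the symmetric matrix `Q` with the stated entries solves the
Lyapunov equation `Aᵀ Q + Q A = −Cᵀ C` and `tr(Bᵀ Q B)` equals the stated
closed-form per-mode squared H2 norm. -/
theorem per_mode_H2_nonzero_eigenvalue
    (m d τ k σζ ση lam : ℝ)
    (hm : 0 < m) (hd : 0 < d) (hτ : 0 < τ) (hk : 0 < k)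
    (hσζ : 0 < σζ) (hση : 0 < ση) (hlam : 0 < lam)
    (A : Matrix (Fin 3) (Fin 3) ℝ)
    (hA : A = !![0, 1, 0; -lam/m, -d/m, -1/m; 0, 1/τ, -k/τ])
    (B : Matrix (Fin 3) (Fin 2) ℝ)
    (hB : B = !![0, 0; σζ/m, 0; 0, ση/τ])
    (C : Matrix (Fin 1) (Fin 3) ℝ)
    (hC : C = !![0, 1, 0])
    (q33 q11 q12 q13 q22 q23 : ℝ)
    (hq33 : q33 = 1 / (2*d*((m/τ^2)*k^2 + (m/(d*τ^2) + d/τ)*k + 1/τ + lam)))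
    (hq11 : q11 = (lam/d) * (-(k*m/τ^2) * q33 + 1/2) - (lam/τ) * q33)
    (hq12 : q12 = 0)
    (hq13 : q13 = lam * q33)
    (hq22 : q22 = (m/d) * (-(k*m/τ^2) * q33 + 1/2))
    (hq23 : q23 = -(k*m/τ) * q33)
    (Q : Matrix (Fin 3) (Fin 3) ℝ)
    (hQ : Q = !![q11, q12, q13; q12, q22, q23; q13, q23, q33]) :
    Aᵀ * Q + Q * A = -(Cᵀ * C) ∧
    (Bᵀ * Q * B).trace =
      ((k/τ^2) * (-σζ^2/d + ση^2/k))
        / (2*d*((m/τ^2)*k^2 + (m/(d*τ^2) + d/τ)*k + 1/τ + lam))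
      + σζ^2 / (2*m*d) := by
  have hden : 0 < 2*d*((m/τ^2)*k^2 + (m/(d*τ^2) + d/τ)*k + 1/τ + lam) := by positivity
  have hq33_mul : q33 * (2*d*((m/τ^2)*k^2 + (m/(d*τ^2) + d/τ)*k + 1/τ + lam)) = 1 := by
    rw [hq33, one_div_mul_cancel hden.ne']
  constructor
  · have h12 : -lam/m * q22 + q11 + q13/τ = 0 := by
      rw [hq22, hq11, hq13]; field_simp; ring
    have h13 : -lam/m * q23 - k/τ * q13 = 0 := by
      rw [hq23, hq13]; field_simp; ring
    have h22 : -d/m * q22 + q23/τ = -1/2 := by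
      rw [hq22, hq23]; field_simp; ring
    have h23 : q13 - d/m * q23 + q33/τ - q22/m - k/τ * q23 = 0 := by
      have h : q13 - d/m * q23 + q33/τ - q22/m - k/τ * q23 =
          (q33 * (2*d*((m/τ^2)*k^2 + (m/(d*τ^2) + d/τ)*k + 1/τ + lam)) - 1) / (2*d) := by
        rw [hq13, hq23, hq22]; field_simp; ring
      rw [h, hq33_mul, sub_self, zero_div]
    have h33 : -q23/m - k/τ * q33 = 0 := by
      rw [hq23]; field_simp; ring
    subst hA hC hQ hq12
    ext i j
    fin_cases i <;> fin_cases j <;>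
      simp [Matrix.mul_apply, Fin.sum_univ_succ] <;> grind
  · have htrace : (Bᵀ * Q * B).trace = (σζ/m)^2 * q22 + (ση/τ)^2 * q33 := by
      rw [hB, hQ]
      simp [Matrix.trace, Matrix.mul_apply, Fin.sum_univ_succ]
      ring
    rw [htrace, div_eq_mul_one_div _ (2*d*_), ← hq33, hq22]
    field_simp
    ring
end

section
/- Per-mode H2 computation under leaky integral control (Theorem 8, zero eigenvalue mode): Let m, d, τ, k, σ_ζ, σ_η > 0. Define the real 2×2 matrix A = [[−d/m, −1/m], [1/τ, −k/τ]], the 2×2 matrix B = [[σ_ζ/m, 0], [0, σ_η/τ]], and the 1×2 matrix C = [1, 0]. Then there exists a symmetric 2×2 matrix Q satisfying Aᵀ Q + Q A = −Cᵀ C with tr(Bᵀ Q B) = ((k/τ²)(−σ_ζ²/d + σ_η²/k)) / (2d ((m/τ²) k² + (m/(dτ²) + d/τ) k + 1/τ)) + σ_ζ²/(2 m d). -/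
open Matrix

/-- Per-mode H2 computation under leaky integral control (Theorem 8, zero
eigenvalue mode): for the reduced 2×2 system there exists a symmetric `Q`
solving the Lyapunov equation `Aᵀ Q + Q A = −Cᵀ C` whose `tr(Bᵀ Q B)` equals
the stated closed-form per-mode squared H2 norm. -/
theorem per_mode_H2_zero_eigenvalue
    (m d τ k σζ ση : ℝ)
    (hm : 0 < m) (hd : 0 < d) (hτ : 0 < τ) (hk : 0 < k)
    (hσζ : 0 < σζ) (hση : 0 < ση)
    (A : Matrix (Fin 2) (Fin 2) ℝ)
    (hA : A = !![-d/m, -1/m; 1/τ, -k/τ])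
    (B : Matrix (Fin 2) (Fin 2) ℝ)
    (hB : B = !![σζ/m, 0; 0, ση/τ])
    (C : Matrix (Fin 1) (Fin 2) ℝ)
    (hC : C = !![1, 0]) :
    ∃ Q : Matrix (Fin 2) (Fin 2) ℝ, Q.IsSymm ∧
      Aᵀ * Q + Q * A = -(Cᵀ * C) ∧
      (Bᵀ * Q * B).trace =
        ((k/τ^2) * (-σζ^2/d + ση^2/k))
          / (2*d*((m/τ^2)*k^2 + (m/(d*τ^2) + d/τ)*k + 1/τ))
        + σζ^2 / (2*m*d) := by
  have hE : 0 < (m/τ^2)*k^2 + (m/(d*τ^2) + d/τ)*k + 1/τ := by positivity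
  obtain ⟨E, hEdef⟩ : ∃ E, E = (m/τ^2)*k^2 + (m/(d*τ^2) + d/τ)*k + 1/τ := ⟨_, rfl⟩
  rw [← hEdef] at hE ⊢
  have hEmul : E * (d * τ^2) = m*d*k^2 + m*k + d^2*τ*k + d*τ := by
    rw [hEdef]
    field_simp
    ring
  subst hA hB hC
  refine ⟨!![m/(2*d) - m^2*k/(2*d^2*τ^2*E), -(m*k)/(2*d*τ*E);
    -(m*k)/(2*d*τ*E), 1/(2*d*E)], ?_, ?_, ?_⟩
  · ext i j
    fin_cases i <;> fin_cases j <;> rfl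
  · ext i j
    fin_cases i <;> fin_cases j <;>
      simp [Matrix.mul_apply, Fin.sum_univ_two] <;> field_simp <;>
      first | ring1 | linear_combination -hEmul
  · simp [Matrix.trace, Matrix.mul_apply, Fin.sum_univ_two]
    field_simp
    ring
end

section
/- Monotonicity of the H2 norm, part 1 (Corollary 10): Let n ≥ 1, m, d, τ, σ_ζ, σ_η > 0 and λ_1, …, λ_n ≥ 0. Then for every k > 0, the squared H2 norm under leaky integral control is strictly smaller than under pure integral control: F(k, τ) < F(0, τ). -/
/-- The squared H2 norm of the linearized power system under homogeneous
leaky integral control with gain `k` and time constant `τ`. -/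
noncomputable def leakyH2 (n : ℕ) (m d σζ ση : ℝ) (lam : Fin n → ℝ)
    (k τ : ℝ) : ℝ :=
  n * σζ^2 / (2 * m * d)
    + ∑ i, (ση^2 - (k / d) * σζ^2)
        / (2 * d * (m * k^2 + (m / d + d * τ) * k + τ + lam i * τ^2))

/-- Monotonicity of the H2 norm, part 1 (Corollary 10): for every `k > 0`,
the squared H2 norm under leaky integral control is strictly smaller than
under pure integral control (`k = 0`). -/
theorem leakyH2_lt_integratorH2
    (n : ℕ) (hn : 1 ≤ n) (m d τ σζ ση : ℝ)
    (hm : 0 < m) (hd : 0 < d) (hτ : 0 < τ) (hσζ : 0 < σζ) (hση : 0 < ση)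
    (lam : Fin n → ℝ) (hlam : ∀ i, 0 ≤ lam i)
    (k : ℝ) (hk : 0 < k) :
    leakyH2 n m d σζ ση lam k τ < leakyH2 n m d σζ ση lam 0 τ := by
  have : NeZero n := ⟨by omega⟩
  unfold leakyH2
  gcongr ?_ + ?_
  refine Finset.sum_lt_sum_of_nonempty Finset.univ_nonempty fun i _ => ?_
  have hl : 0 ≤ lam i * τ ^ 2 := mul_nonneg (hlam i) (sq_nonneg τ)
  refine div_lt_div₀ ?_ ?_ ?_ ?_
  · have : 0 < k / d * σζ ^ 2 := by positivity
    simpa using this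
  · gcongr
  · simpa using sq_nonneg ση
  · positivity
end

section
/- Monotonicity of the H2 norm, part 2 (Corollary 10, measurement noise only): Let n ≥ 1, m, d, σ_η > 0 and λ_1, …, λ_n ≥ 0, and set σ_ζ = 0, so that the squared H2 norm reduces to F_η(k, τ) = Σ_{i=1}^n σ_η² / (2 d (m k² + (m/d + d τ) k + τ + λ_i τ²)). Then: (i) for every fixed τ > 0, the map k ↦ F_η(k, τ) is strictly decreasing on [0, ∞); and (ii) for every fixed k > 0, the map τ ↦ F_η(k, τ) is strictly decreasing on [0, ∞). -/
/-- The squared H2 norm under homogeneous leaky integral control in the case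
of measurement noise only (`σζ = 0`). -/
noncomputable def leakyH2noise (n : ℕ) (m d ση : ℝ) (lam : Fin n → ℝ)
    (k τ : ℝ) : ℝ :=
  ∑ i, ση^2 / (2 * d * (m * k^2 + (m / d + d * τ) * k + τ + lam i * τ^2))

/-- A sum of fractions with a common positive numerator over a nonempty index set decreases
strictly when all the positive denominators increase strictly. -/
theorem sum_div_lt_sum_div_of_denom_lt {ι : Type*} {s : Finset ι} (hs : s.Nonempty)
    {c : ℝ} (hc : 0 < c) {f g : ι → ℝ} (hf : ∀ i ∈ s, 0 < f i) (hfg : ∀ i ∈ s, f i < g i) :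
    ∑ i ∈ s, c / g i < ∑ i ∈ s, c / f i :=
  Finset.sum_lt_sum_of_nonempty hs fun i hi =>
    div_lt_div_of_pos_left hc (hf i hi) (hfg i hi)

/-- Monotonicity of the H2 norm, part 2 (Corollary 10, measurement noise
only): with `σζ = 0`, for every fixed `τ > 0` the map `k ↦ F_η(k, τ)` is
strictly decreasing on `[0, ∞)`, and for every fixed `k > 0` the map
`τ ↦ F_η(k, τ)` is strictly decreasing on `[0, ∞)`. -/
theorem leakyH2noise_strictAnti
    (n : ℕ) (hn : 1 ≤ n) (m d ση : ℝ)
    (hm : 0 < m) (hd : 0 < d) (hση : 0 < ση)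
    (lam : Fin n → ℝ) (hlam : ∀ i, 0 ≤ lam i) :
    (∀ τ : ℝ, 0 < τ →
      StrictAntiOn (fun k => leakyH2noise n m d ση lam k τ) (Set.Ici 0)) ∧
    (∀ k : ℝ, 0 < k →
      StrictAntiOn (fun τ => leakyH2noise n m d ση lam k τ) (Set.Ici 0)) := by
  have hne : (Finset.univ : Finset (Fin n)).Nonempty := ⟨⟨0, hn⟩, Finset.mem_univ _⟩
  have hση2 : 0 < ση ^ 2 := by positivity
  refine ⟨fun τ hτ a ha b _ hab => ?_, fun k hk a ha b _ hab => ?_⟩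
  · have ha0 : 0 ≤ a := ha
    refine sum_div_lt_sum_div_of_denom_lt hne hση2 (fun i _ => ?_) (fun i _ => ?_)
    · have := hlam i
      positivity
    · have := hlam i
      gcongr
  · have ha0 : 0 ≤ a := ha
    refine sum_div_lt_sum_div_of_denom_lt hne hση2 (fun i _ => ?_) (fun i _ => ?_)
    · have := hlam i
      positivity
    · have := hlam i
      have h1 : d * a * k < d * b * k := by gcongr
      have h2 : lam i * a ^ 2 ≤ lam i * b ^ 2 := by gcongr
      refine mul_lt_mul_of_pos_left ?_ (by positivity)
      linarith
end

section
/- H2 optimal tuning, part 2 (Corollary 11): Let n ≥ 1 and m, d, σ_ζ, σ_η > 0, and set k* = (d σ_η² + σ_η √(d² σ_η² + σ_ζ²)) / σ_ζ². Then: (i) k* is the unique positive root of the quadratic p(k) = σ_ζ² k² − 2 d σ_η² k − σ_η²; and (ii) for arbitrary Laplacian eigenvalues λ_1, …, λ_n ≥ 0, k* minimizes the squared H2 norm at τ = 0 over all positive gains: F(k, 0) ≥ F(k*, 0) for every k > 0. -/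
/-- At a root `s` of `a s² - 2 d b s - b` with `d b ≤ a s`, the function
`k ↦ (b - (k / d) a) / (2 d (m k² + (m / d) k))` attains its minimum over `k > 0`. -/
theorem leakyH2_summand_le {m d a b s k : ℝ} (hm : 0 < m) (hd : 0 < d)
    (hs : 0 < s) (hk : 0 < k) (hroot : a * s^2 - 2 * d * b * s - b = 0)
    (hsb : d * b ≤ a * s) :
    (b - (s / d) * a) / (2 * d * (m * s^2 + (m / d) * s))
      ≤ (b - (k / d) * a) / (2 * d * (m * k^2 + (m / d) * k)) := by
  have normalize (x : ℝ) (hx : 0 < x) :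
      (b - (x / d) * a) / (2 * d * (m * x^2 + (m / d) * x))
        = (d * b - a * x) / (2 * d * m * (x * (d * x + 1))) := by
    field_simp
  rw [normalize s hs, normalize k hk, div_le_div_iff₀ (by positivity) (by positivity)]
  have gap : (d * b - a * k) * (s * (d * s + 1)) - (d * b - a * s) * (k * (d * k + 1))
      = d * (a * s - d * b) * (k - s)^2 := by
    linear_combination d * (k - s) * hroot
  have gap_nonneg : 0 ≤ d * (a * s - d * b) * (k - s)^2 :=
    mul_nonneg (mul_nonneg hd.le (sub_nonneg.2 hsb)) (sq_nonneg _)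
  rw [← gap] at gap_nonneg
  have := mul_nonneg (by positivity : 0 ≤ 2 * d * m) gap_nonneg
  linarith

/-- H2 optimal tuning, part 2 (Corollary 11): with
`k* = (d ση² + ση √(d² ση² + σζ²))/σζ²`, (i) `k*` is the unique positive root
of `p(k) = σζ² k² − 2 d ση² k − ση²`, and (ii) for arbitrary Laplacian
eigenvalues `λ_i ≥ 0`, `k*` minimizes the squared H2 norm at `τ = 0` over all
positive gains. -/
theorem leakyH2_optimal_gain
    (n : ℕ) (hn : 1 ≤ n) (m d σζ ση : ℝ)
    (hm : 0 < m) (hd : 0 < d) (hσζ : 0 < σζ) (hση : 0 < ση)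
    (kstar : ℝ)
    (hkstar : kstar = (d * ση^2 + ση * Real.sqrt (d^2 * ση^2 + σζ^2)) / σζ^2) :
    (0 < kstar ∧
      σζ^2 * kstar^2 - 2 * d * ση^2 * kstar - ση^2 = 0 ∧
      ∀ k : ℝ, 0 < k → σζ^2 * k^2 - 2 * d * ση^2 * k - ση^2 = 0 → k = kstar) ∧
    (∀ lam : Fin n → ℝ, (∀ i, 0 ≤ lam i) → ∀ k : ℝ, 0 < k →
      leakyH2 n m d σζ ση lam k 0 ≥ leakyH2 n m d σζ ση lam kstar 0) := by
  have hsqrt_pos : 0 < Real.sqrt (d^2 * ση^2 + σζ^2) := Real.sqrt_pos.2 (by positivity)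
  have hsqrt_sq := Real.sq_sqrt (by positivity : 0 ≤ d^2 * ση^2 + σζ^2)
  set r := Real.sqrt (d^2 * ση^2 + σζ^2)
  have hpos : 0 < kstar := by rw [hkstar]; positivity
  have hmul : σζ^2 * kstar = d * ση^2 + ση * r := by rw [hkstar]; field_simp
  have hroot : σζ^2 * kstar^2 - 2 * d * ση^2 * kstar - ση^2 = 0 := by
    have : σζ^2 * (σζ^2 * kstar^2 - 2 * d * ση^2 * kstar - ση^2) = 0 := by
      linear_combination (σζ^2 * kstar - d * ση^2 + ση * r) * hmul + ση^2 * hsqrt_sq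
    exact (mul_eq_zero.1 this).resolve_left (by positivity)
  refine ⟨⟨hpos, hroot, fun k hk hkroot => ?_⟩, fun lam _ k hk => ?_⟩
  · have hfactor : (σζ^2 * k * kstar + ση^2) * (k - kstar) = 0 := by
      linear_combination kstar * hkroot - k * hroot
    exact sub_eq_zero.1 ((mul_eq_zero.1 hfactor).resolve_left (by positivity))
  · simp only [leakyH2, mul_zero, add_zero, ne_eq, OfNat.ofNat_ne_zero, not_false_eq_true,
      zero_pow, ge_iff_le]
    have hlb : d * ση^2 ≤ σζ^2 * kstar := by
      rw [hmul]
      exact le_add_of_nonneg_right (by positivity)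
    exact add_le_add_right
      (Finset.sum_le_sum fun _ _ => leakyH2_summand_le hm hd hpos hk hroot hlb) _
end
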